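/- For every τ in the upper half plane ℍ and every z ∈ ℂ \ L_τ, the Weierstrass functions satisfy the differential equation ℘′_τ(z)² = 4 ℘_τ(z)³ − g₂(τ) ℘_τ(z) − g₃(τ). -/

import Mathlib

/-- A lattice point mτ + n of the lattice L_τ = ℤ + ℤτ, indexed by (m, n) ∈ ℤ × ℤ. -/
noncomputable def latPt (τ : ℂ) (p : ℤ × ℤ) : ℂ := (p.1 : ℂ) * τ + (p.2 : ℂ)

/-- g₂(τ) = 60 Σ_{ω ∈ L_τ, ω ≠ 0} ω⁻⁴. -/
noncomputable def gTwo (τ : ℂ) : ℂ := 60 * ∑' p : {p : ℤ × ℤ // p ≠ 0}, 1 / latPt τ p.1 ^ 4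

/-- g₃(τ) = 140 Σ_{ω ∈ L_τ, ω ≠ 0} ω⁻⁶. -/
noncomputable def gThree (τ : ℂ) : ℂ := 140 * ∑' p : {p : ℤ × ℤ // p ≠ 0}, 1 / latPt τ p.1 ^ 6

/-- The Weierstrass ℘-function
℘_τ(z) = 1/z² + Σ_{ω ∈ L_τ, ω ≠ 0} ( 1/(z−ω)² − 1/ω² ). -/
noncomputable def wp (τ z : ℂ) : ℂ :=
  1 / z ^ 2 + ∑' p : {p : ℤ × ℤ // p ≠ 0}, (1 / (z - latPt τ p.1) ^ 2 - 1 / latPt τ p.1 ^ 2)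

/-- The derivative ℘′_τ(z) = −2 Σ_{ω ∈ L_τ} 1/(z−ω)³. -/
noncomputable def wp' (τ z : ℂ) : ℂ := -2 * ∑' p : ℤ × ℤ, 1 / (z - latPt τ p) ^ 3

/-- The period pair `(τ, 1)` attached to a point of the upper half plane. -/
noncomputable def periodPairOfUpperHalfPlane (τ : ℂ) (hτ : 0 < τ.im) : PeriodPair where
  ω₁ := τ
  ω₂ := 1
  indep := by
    refine LinearIndependent.pair_iff.mpr fun s t h ↦ ?_
    have him := congrArg Complex.im h
    have hre := congrArg Complex.re h
    have hs : s = 0 := by simpa [hτ.ne'] using him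
    exact ⟨hs, by simpa [hs] using hre⟩

namespace periodPairOfUpperHalfPlane

variable {τ : ℂ} (hτ : 0 < τ.im)

lemma coe_latticeEquivProd_symm (p : ℤ × ℤ) :
    ((periodPairOfUpperHalfPlane τ hτ).latticeEquivProd.symm p : ℂ) = latPt τ p := by
  rw [PeriodPair.latticeEquiv_symm_apply]
  simp [periodPairOfUpperHalfPlane, latPt]

lemma tsum_lattice (f : ℂ → ℂ) :
    ∑' l : (periodPairOfUpperHalfPlane τ hτ).lattice, f l = ∑' p : ℤ × ℤ, f (latPt τ p) := by
  rw [← (periodPairOfUpperHalfPlane τ hτ).latticeEquivProd.symm.toEquiv.tsum_eq]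
  exact tsum_congr fun p ↦ congrArg f (coe_latticeEquivProd_symm hτ p)

lemma tsum_lattice_of_map_zero {f : ℂ → ℂ} (hf : f 0 = 0) :
    ∑' l : (periodPairOfUpperHalfPlane τ hτ).lattice, f l =
      ∑' p : {p : ℤ × ℤ // p ≠ 0}, f (latPt τ p.1) := by
  rw [tsum_lattice]
  refine (tsum_subtype_eq_of_support_subset (f := fun p ↦ f (latPt τ p))
    (s := {p : ℤ × ℤ | p ≠ 0}) ?_).symm
  rintro p hp rfl
  exact hp (by simpa [latPt] using hf)

lemma latPt_ne_zero (hτ : 0 < τ.im) {p : ℤ × ℤ} (hp : p ≠ 0) : latPt τ p ≠ 0 := by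
  rw [← coe_latticeEquivProd_symm hτ]
  simpa using hp

lemma g₂_eq_gTwo : (periodPairOfUpperHalfPlane τ hτ).g₂ = gTwo τ := by
  simp only [PeriodPair.g₂, PeriodPair.G, gTwo, one_div]
  rw [tsum_lattice_of_map_zero hτ (f := fun l ↦ (l ^ 4)⁻¹) (by simp)]

lemma g₃_eq_gThree : (periodPairOfUpperHalfPlane τ hτ).g₃ = gThree τ := by
  simp only [PeriodPair.g₃, PeriodPair.G, gThree, one_div]
  rw [tsum_lattice_of_map_zero hτ (f := fun l ↦ (l ^ 6)⁻¹) (by simp)]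

lemma weierstrassP_eq_wp (z : ℂ) :
    (periodPairOfUpperHalfPlane τ hτ).weierstrassP z = wp τ z := by
  rw [← PeriodPair.weierstrassPExcept_add _ 0, PeriodPair.weierstrassPExcept,
    tsum_lattice_of_map_zero hτ
      (f := fun l ↦ if l = ((0 : (periodPairOfUpperHalfPlane τ hτ).lattice) : ℂ) then 0
        else 1 / (z - l) ^ 2 - 1 / l ^ 2) (by simp), wp, add_comm]
  congr 1
  · simp
  · exact tsum_congr fun p ↦ if_neg (latPt_ne_zero hτ p.2)

lemma derivWeierstrassP_eq_wp' (z : ℂ) :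
    (periodPairOfUpperHalfPlane τ hτ).derivWeierstrassP z = wp' τ z := by
  rw [PeriodPair.derivWeierstrassP, tsum_lattice hτ (fun l ↦ 2 / (z - l) ^ 3), wp', neg_mul,
    ← tsum_mul_left]
  simp only [mul_one_div]

end periodPairOfUpperHalfPlane

/-- For τ in the upper half plane and z ∈ ℂ \\ L_τ, the Weierstrass functions satisfy
℘′_τ(z)² = 4℘_τ(z)³ − g₂(τ)℘_τ(z) − g₃(τ). -/
theorem weierstrass_differential_equation (τ : ℂ) (hτ : 0 < τ.im) (z : ℂ)
    (hz : ∀ m n : ℤ, z ≠ (m : ℂ) * τ + (n : ℂ)) :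
    wp' τ z ^ 2 = 4 * wp τ z ^ 3 - gTwo τ * wp τ z - gThree τ := by
  have hmem : z ∉ (periodPairOfUpperHalfPlane τ hτ).lattice := by
    rw [PeriodPair.mem_lattice]
    rintro ⟨m, n, h⟩
    exact hz m n (by simpa [periodPairOfUpperHalfPlane] using h.symm)
  simpa only [periodPairOfUpperHalfPlane.g₂_eq_gTwo, periodPairOfUpperHalfPlane.g₃_eq_gThree,
    periodPairOfUpperHalfPlane.weierstrassP_eq_wp,
    periodPairOfUpperHalfPlane.derivWeierstrassP_eq_wp'] using
    (periodPairOfUpperHalfPlane τ hτ).derivWeierstrassP_sq z hmem
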